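/- Hardy-type inequality with a unimodal weight: let a ≤ c ≤ b be real numbers, let w : [a,b] → ℝ be positive, nondecreasing on [a,c] and nonincreasing on [c,b], and let g : [a,b] → ℂ be measurable with ∫_a^b |g(t)|²·w(t) dt < ∞. Define u(θ) = ∫_{c}^{θ} g(t) dt (a signed integral, so u(θ) = −∫_{θ}^{c} g for θ < c). Then ∫_a^b |u(θ)|²·w(θ) dθ ≤ (b − a)² · ∫_a^b |g(θ)|²·w(θ) dθ; in particular the constant is independent of w. (This is the estimate used at the end of the proof of Lemma 4.1, where w(θ) = e^{−2Re φ(re^{iθ})} increases up to θ_{1/2} and decreases afterwards, with a constant independent of r.) -/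

import Mathlib

open MeasureTheory

/-- Cauchy–Schwarz against the constant function `1`. -/
theorem sq_lintegral_le_measure_univ_mul {α : Type*} [MeasurableSpace α] (μ : Measure α)
    {f : α → ENNReal} (hf : AEMeasurable f μ) :
    (∫⁻ x, f x ∂μ) ^ 2 ≤ μ Set.univ * ∫⁻ x, f x ^ 2 ∂μ := by
  have h := ENNReal.lintegral_mul_le_Lp_mul_Lq μ Real.HolderConjugate.two_two hf
    (aemeasurable_const (b := (1 : ENNReal)))
  simp only [Pi.mul_apply, mul_one, ENNReal.rpow_ofNat, one_pow, lintegral_one] at h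
  calc (∫⁻ x, f x ∂μ) ^ 2
      ≤ ((∫⁻ x, f x ^ 2 ∂μ) ^ (1 / 2 : ℝ) * μ Set.univ ^ (1 / 2 : ℝ)) ^ 2 := by gcongr
    _ = μ Set.univ * ∫⁻ x, f x ^ 2 ∂μ := by
      rw [mul_pow, ← ENNReal.rpow_mul_natCast, ← ENNReal.rpow_mul_natCast, mul_comm]
      norm_num

theorem ofReal_norm_sq_mul {E : Type*} [SeminormedAddCommGroup E] (z : E) (r : ℝ) :
    ENNReal.ofReal (‖z‖ ^ 2 * r) = ‖z‖ₑ ^ 2 * ENNReal.ofReal r := by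
  rw [ENNReal.ofReal_mul (by positivity), ENNReal.ofReal_pow (norm_nonneg _), ofReal_norm]

/-- Pointwise weighted bound for a primitive, when the weight at the endpoint is at most the weight
on the interval of integration. -/
theorem ofReal_norm_intervalIntegral_sq_mul_le {E : Type*} [NormedAddCommGroup E]
    [NormedSpace ℝ E] {g : ℝ → E} {w : ℝ → ℝ} {c θ : ℝ}
    (hg : AEStronglyMeasurable g (volume.restrict (Set.uIoc c θ)))
    (hw : ∀ t ∈ Set.uIoc c θ, w θ ≤ w t) :
    ENNReal.ofReal (‖∫ t in c..θ, g t‖ ^ 2 * w θ) ≤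
      volume (Set.uIoc c θ) * ∫⁻ t in Set.uIoc c θ, ENNReal.ofReal (‖g t‖ ^ 2 * w t) := by
  have h1 : ‖∫ t in c..θ, g t‖ₑ ≤ ∫⁻ t in Set.uIoc c θ, ‖g t‖ₑ := by
    rw [← ofReal_norm, intervalIntegral.norm_intervalIntegral_eq, ofReal_norm]
    exact enorm_integral_le_lintegral_enorm _
  have h2 := sq_lintegral_le_measure_univ_mul _ hg.enorm
  rw [Measure.restrict_apply_univ] at h2
  calc ENNReal.ofReal (‖∫ t in c..θ, g t‖ ^ 2 * w θ)
      = ‖∫ t in c..θ, g t‖ₑ ^ 2 * ENNReal.ofReal (w θ) := ofReal_norm_sq_mul _ _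
    _ ≤ (volume (Set.uIoc c θ) * ∫⁻ t in Set.uIoc c θ, ‖g t‖ₑ ^ 2) * ENNReal.ofReal (w θ) := by
      gcongr
      exact (pow_le_pow_left₀ zero_le h1 2).trans h2
    _ = volume (Set.uIoc c θ) * ∫⁻ t in Set.uIoc c θ, ‖g t‖ₑ ^ 2 * ENNReal.ofReal (w θ) := by
      rw [lintegral_mul_const' _ _ ENNReal.ofReal_ne_top, mul_assoc]
    _ ≤ _ := by
      refine mul_le_mul' le_rfl (setLIntegral_mono' measurableSet_uIoc fun t ht => ?_)
      rw [ofReal_norm_sq_mul]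
      gcongr
      exact hw t ht

/-- Hardy-type inequality with a positive unimodal weight: nondecreasing on `[a,c]`,
nonincreasing on `[c,b]`, with primitive taken from the peak `c`. -/
theorem hardy_unimodal_weight (a c b : ℝ) (hac : a ≤ c) (hcb : c ≤ b)
    (w : ℝ → ℝ) (g : ℝ → ℂ)
    (hw_pos : ∀ t ∈ Set.Icc a b, 0 < w t)
    (hw_incr : ∀ s ∈ Set.Icc a c, ∀ t ∈ Set.Icc a c, s ≤ t → w s ≤ w t)
    (hw_decr : ∀ s ∈ Set.Icc c b, ∀ t ∈ Set.Icc c b, s ≤ t → w t ≤ w s)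
    (hg : Measurable g)
    (hfin : ∫⁻ t in Set.Icc a b, ENNReal.ofReal (‖g t‖ ^ 2 * w t) < ⊤) :
    ∫⁻ θ in Set.Icc a b, ENNReal.ofReal (‖∫ t in c..θ, g t‖ ^ 2 * w θ)
      ≤ ENNReal.ofReal ((b - a) ^ 2) *
        ∫⁻ θ in Set.Icc a b, ENNReal.ofReal (‖g θ‖ ^ 2 * w θ) := by
  have hpt : ∀ θ ∈ Set.Icc a b, ENNReal.ofReal (‖∫ t in c..θ, g t‖ ^ 2 * w θ) ≤
      ENNReal.ofReal (b - a) * ∫⁻ t in Set.Icc a b, ENNReal.ofReal (‖g t‖ ^ 2 * w t) := by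
    intro θ hθ
    have hsub : Set.uIoc c θ ⊆ Set.Icc a b :=
      Set.uIoc_subset_uIcc.trans (Set.uIcc_subset_Icc ⟨hac, hcb⟩ hθ)
    refine (ofReal_norm_intervalIntegral_sq_mul_le hg.aestronglyMeasurable fun t ht => ?_).trans ?_
    · rcases le_total c θ with h | h
      · rw [Set.uIoc_of_le h] at ht
        exact hw_decr t ⟨ht.1.le, ht.2.trans hθ.2⟩ θ ⟨h, hθ.2⟩ ht.2
      · rw [Set.uIoc_of_ge h] at ht
        exact hw_incr θ ⟨hθ.1, h⟩ t ⟨hθ.1.trans ht.1.le, ht.2⟩ ht.1.le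
    · gcongr
      exact (measure_mono hsub).trans Real.volume_Icc.le
  refine (setLIntegral_mono' measurableSet_Icc hpt).trans (le_of_eq ?_)
  rw [setLIntegral_const, Real.volume_Icc, ENNReal.ofReal_pow (by linarith)]
  ring
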